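/- arXiv:2103.05982 — 2 statements merged into one kernel-verified Lean document; each statement's English description precedes it below -/
import Mathlib

section
/- For every smooth field φ and every point x, Σ_μ ∂_μ H^μ(x) = Σ_A E_A(x) · ∂_0 φ^A(x). In particular, if φ satisfies the Euler–Lagrange equations E_A ≡ 0, then the canonical energy current H^μ is divergence-free. -/
/-!
Statement 1: For a smooth first-order Lagrangian `L` and a smooth field `φ`,
the divergence of the Noether (canonical energy) current associated with the
translation `X = ∂₀` equals `Σ_A E_A ∂₀φ^A`.
-/

noncomputable section

open scoped BigOperators

/-- Partial derivative of a real-valued function on `Fin n → ℝ` along coordinate `i`. -/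
def pd {n : ℕ} (i : Fin n) (f : (Fin n → ℝ) → ℝ) (x : Fin n → ℝ) : ℝ :=
  fderiv ℝ f x (Pi.single i 1)

/-- First jet of a field. -/
def jet {m n : ℕ} (φ : (Fin n → ℝ) → (Fin m → ℝ)) (x : Fin n → ℝ) :
    (Fin m → ℝ) × (Fin m → Fin n → ℝ) :=
  (φ x, fun A μ => pd μ (fun y => φ y A) x)

/-- Canonical momentum `π_A^μ`: derivative of `L` with respect to the derivative
slot `φ^A_μ`, evaluated at the first jet of `φ`. -/
def mom {m n : ℕ} (L : (Fin m → ℝ) × (Fin m → Fin n → ℝ) → ℝ)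
    (φ : (Fin n → ℝ) → (Fin m → ℝ)) (A : Fin m) (μ : Fin n) (x : Fin n → ℝ) : ℝ :=
  fderiv ℝ L (jet φ x) (0, Pi.single A (Pi.single μ 1))

/-- `π_A`: derivative of `L` with respect to the field slot `φ^A`, evaluated at
the first jet of `φ`. -/
def momF {m n : ℕ} (L : (Fin m → ℝ) × (Fin m → Fin n → ℝ) → ℝ)
    (φ : (Fin n → ℝ) → (Fin m → ℝ)) (A : Fin m) (x : Fin n → ℝ) : ℝ :=
  fderiv ℝ L (jet φ x) (Pi.single A 1, 0)

/-- Euler–Lagrange expression `E_A = Σ_μ ∂_μ π_A^μ − π_A`. -/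
def EL {m n : ℕ} (L : (Fin m → ℝ) × (Fin m → Fin n → ℝ) → ℝ)
    (φ : (Fin n → ℝ) → (Fin m → ℝ)) (A : Fin m) (x : Fin n → ℝ) : ℝ :=
  (∑ μ, pd μ (mom L φ A μ) x) - momF L φ A x

/-- Noether (canonical energy) current `H^μ = Σ_A π_A^μ ∂₀φ^A − δ^μ₀ L(j(x))`. -/
def noether {m n : ℕ} [NeZero n] (L : (Fin m → ℝ) × (Fin m → Fin n → ℝ) → ℝ)
    (φ : (Fin n → ℝ) → (Fin m → ℝ)) (μ : Fin n) (x : Fin n → ℝ) : ℝ :=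
  (∑ A, mom L φ A μ x * pd 0 (fun y => φ y A) x)
    - (if μ = 0 then L (jet φ x) else 0)

theorem contDiff_pd {n : ℕ} {f : (Fin n → ℝ) → ℝ} (hf : ContDiff ℝ (⊤ : ℕ∞) f) (i : Fin n) :
    ContDiff ℝ (⊤ : ℕ∞) (pd i f) :=
  (hf.fderiv_right (m := (⊤ : ℕ∞)) (by simp)).clm_apply contDiff_const

theorem pd_comm {n : ℕ} {f : (Fin n → ℝ) → ℝ} (hf : ContDiff ℝ (⊤ : ℕ∞) f) (i j : Fin n)
    (x : Fin n → ℝ) : pd i (pd j f) x = pd j (pd i f) x := by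
  have hd : DifferentiableAt ℝ (fderiv ℝ f) x :=
    (hf.fderiv_right (m := (⊤ : ℕ∞)) (by simp)).differentiable (by simp) x
  have key : ∀ k l : Fin n, pd k (pd l f) x
      = fderiv ℝ (fderiv ℝ f) x (Pi.single k 1) (Pi.single l 1) := by
    intro k l
    have h := hd.hasFDerivAt.clm_apply (hasFDerivAt_const (Pi.single l (1 : ℝ)) x)
    change fderiv ℝ (fun y => fderiv ℝ f y (Pi.single l 1)) x _ = _
    rw [h.fderiv]
    simp
  have hsymm : IsSymmSndFDerivAt ℝ f x :=
    hf.contDiffAt.isSymmSndFDerivAt (by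
      rw [minSmoothness_of_isRCLikeNormedField]; exact WithTop.coe_le_coe.2 (le_top (a := (2 : ℕ∞))))
  rw [key, key, hsymm.eq]

theorem contDiff_component {m n : ℕ} {φ : (Fin n → ℝ) → (Fin m → ℝ)}
    (hφ : ContDiff ℝ (⊤ : ℕ∞) φ) (A : Fin m) : ContDiff ℝ (⊤ : ℕ∞) (fun y => φ y A) :=
  contDiff_pi.1 hφ A

theorem contDiff_jet {m n : ℕ} {φ : (Fin n → ℝ) → (Fin m → ℝ)}
    (hφ : ContDiff ℝ (⊤ : ℕ∞) φ) : ContDiff ℝ (⊤ : ℕ∞) (jet φ) :=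
  hφ.prodMk (contDiff_pi.2 fun A => contDiff_pi.2 fun μ =>
    contDiff_pd (contDiff_component hφ A) μ)

theorem contDiff_mom {m n : ℕ} {L : (Fin m → ℝ) × (Fin m → Fin n → ℝ) → ℝ}
    (hL : ContDiff ℝ (⊤ : ℕ∞) L) {φ : (Fin n → ℝ) → (Fin m → ℝ)}
    (hφ : ContDiff ℝ (⊤ : ℕ∞) φ) (A : Fin m) (μ : Fin n) :
    ContDiff ℝ (⊤ : ℕ∞) (mom L φ A μ) :=
  ((hL.fderiv_right (m := (⊤ : ℕ∞)) (by simp)).comp (contDiff_jet hφ)).clm_apply contDiff_const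

/-- The derivative of the jet along a coordinate direction. -/
theorem fderiv_jet_single {m n : ℕ} {φ : (Fin n → ℝ) → (Fin m → ℝ)}
    (hφ : ContDiff ℝ (⊤ : ℕ∞) φ) (i : Fin n) (x : Fin n → ℝ) :
    fderiv ℝ (jet φ) x (Pi.single i 1)
      = (fun A => pd i (fun y => φ y A) x, fun A μ => pd i (pd μ (fun y => φ y A)) x) := by
  have h0 : HasFDerivAt φ
      (ContinuousLinearMap.pi fun A => fderiv ℝ (fun y => φ y A) x) x :=
    hasFDerivAt_pi.2 fun A =>
      ((contDiff_component hφ A).differentiable (by simp) x).hasFDerivAt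
  have h1 : HasFDerivAt (fun y A μ => pd μ (fun z => φ z A) y)
      (ContinuousLinearMap.pi fun A => ContinuousLinearMap.pi fun μ =>
        fderiv ℝ (pd μ (fun z => φ z A)) x) x :=
    hasFDerivAt_pi.2 fun A => hasFDerivAt_pi.2 fun μ =>
      ((contDiff_pd (contDiff_component hφ A) μ).differentiable (by simp) x).hasFDerivAt
  have h : HasFDerivAt (jet φ) _ x := h0.prodMk h1
  rw [h.fderiv]
  rfl

/-- A linear functional on the jet space is determined by its values on the coordinate vectors. -/
theorem clm_jet_apply {m n : ℕ} (T : (Fin m → ℝ) × (Fin m → Fin n → ℝ) →L[ℝ] ℝ)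
    (u : Fin m → ℝ) (v : Fin m → Fin n → ℝ) :
    T (u, v) = ∑ A, u A * T (Pi.single A 1, 0)
      + ∑ A, ∑ μ, v A μ * T (0, Pi.single A (Pi.single μ 1)) := by
  have h : ((u, v) : (Fin m → ℝ) × (Fin m → Fin n → ℝ))
      = ∑ A, u A • ((Pi.single A 1, 0) : (Fin m → ℝ) × (Fin m → Fin n → ℝ))
        + ∑ A, ∑ μ, v A μ •
          ((0, Pi.single A (Pi.single μ 1)) : (Fin m → ℝ) × (Fin m → Fin n → ℝ)) := by
    ext A
    · simp [Prod.fst_sum, Finset.sum_apply, Pi.single_apply]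
    · rename_i μ
      simp [Prod.snd_sum, Finset.sum_apply, Pi.single_apply, apply_ite]
  conv_lhs => rw [h]
  simp only [map_add, map_sum, map_smul, smul_eq_mul]

theorem pd_lagrangian_jet {m n : ℕ} {L : (Fin m → ℝ) × (Fin m → Fin n → ℝ) → ℝ}
    (hL : ContDiff ℝ (⊤ : ℕ∞) L) {φ : (Fin n → ℝ) → (Fin m → ℝ)}
    (hφ : ContDiff ℝ (⊤ : ℕ∞) φ) (i : Fin n) (x : Fin n → ℝ) :
    pd i (fun y => L (jet φ y)) x
      = ∑ A, pd i (fun y => φ y A) x * momF L φ A x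
        + ∑ A, ∑ μ, pd i (pd μ (fun y => φ y A)) x * mom L φ A μ x := by
  have h := (hL.differentiable (by simp) (jet φ x)).hasFDerivAt.comp x
    ((contDiff_jet hφ).differentiable (by simp) x).hasFDerivAt
  have h' : pd i (fun y => L (jet φ y)) x
      = fderiv ℝ L (jet φ x) (fderiv ℝ (jet φ) x (Pi.single i 1)) :=
    congrArg (fun T => T (Pi.single i 1)) h.fderiv
  rw [h', fderiv_jet_single hφ, clm_jet_apply]
  rfl

theorem pd_noether {m n : ℕ} [NeZero n] {L : (Fin m → ℝ) × (Fin m → Fin n → ℝ) → ℝ}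
    (hL : ContDiff ℝ (⊤ : ℕ∞) L) {φ : (Fin n → ℝ) → (Fin m → ℝ)}
    (hφ : ContDiff ℝ (⊤ : ℕ∞) φ) (μ : Fin n) (x : Fin n → ℝ) :
    pd μ (noether L φ μ) x
      = ∑ A, (pd μ (mom L φ A μ) x * pd 0 (fun y => φ y A) x
          + mom L φ A μ x * pd μ (pd 0 (fun y => φ y A)) x)
        - if μ = 0 then pd 0 (fun y => L (jet φ y)) x else 0 := by
  have hsum : HasFDerivAt (fun y => ∑ A, mom L φ A μ y * pd 0 (fun z => φ z A) y) _ x :=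
    HasFDerivAt.fun_sum (u := Finset.univ) fun A _ =>
      ((contDiff_mom hL hφ A μ).differentiable (by simp) x).hasFDerivAt.mul
        ((contDiff_pd (contDiff_component hφ A) 0).differentiable (by simp) x).hasFDerivAt
  have hlag : HasFDerivAt (fun y => if μ = 0 then L (jet φ y) else 0)
      (if μ = 0 then fderiv ℝ (fun y => L (jet φ y)) x else 0) x := by
    split_ifs
    · exact ((hL.comp (contDiff_jet hφ)).differentiable (by simp) x).hasFDerivAt
    · exact hasFDerivAt_const 0 x
  have h : HasFDerivAt (noether L φ μ) _ x := hsum.sub hlag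
  rw [pd, h.fderiv, sub_apply, sum_apply]
  congr 1
  · refine Finset.sum_congr rfl fun A _ => ?_
    simp only [add_apply, smul_apply, smul_eq_mul, pd]
    ring
  · split_ifs with hμ
    · rw [hμ]; rfl
    · rfl

theorem noether_divergence {m n : ℕ} [NeZero n]
    (L : (Fin m → ℝ) × (Fin m → Fin n → ℝ) → ℝ) (hL : ContDiff ℝ (⊤ : ℕ∞) L)
    (φ : (Fin n → ℝ) → (Fin m → ℝ)) (hφ : ContDiff ℝ (⊤ : ℕ∞) φ) (x : Fin n → ℝ) :
    (∑ μ, pd μ (noether L φ μ) x)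
      = ∑ A, EL L φ A x * pd 0 (fun y => φ y A) x := by
  simp only [pd_noether hL hφ, Finset.sum_sub_distrib, Finset.sum_ite_eq', Finset.mem_univ,
    if_true, pd_lagrangian_jet hL hφ, EL, sub_mul, Finset.sum_mul, Finset.sum_add_distrib]
  rw [Finset.sum_comm, Finset.sum_comm (f := fun μ A => mom L φ A μ x * _)]
  have hcomm : ∀ A μ, pd 0 (pd μ (fun y => φ y A)) x * mom L φ A μ x
      = mom L φ A μ x * pd μ (pd 0 (fun y => φ y A)) x := fun A μ => by
    rw [pd_comm (contDiff_component hφ A), mul_comm]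
  simp only [hcomm, mul_comm (pd 0 _ x) (momF L φ _ x)]
  ring
end
end

section
/- Let φ : ℝ × (Fin n → ℝ) → (Fin m → ℝ) be a smooth one-parameter family of fields with parameter λ, and for each λ let π_A^μ(λ,·), E_A(λ,·) and H^μ(λ,·) be the momenta, Euler–Lagrange expressions and Noether current of the field φ(λ,·). Then for every μ, every λ and every point x: ∂_λ H^μ = Σ_A ( ∂_0 φ^A · ∂_λ π_A^μ − ∂_0 π_A^μ · ∂_λ φ^A ) + ∂_0( Σ_A π_A^μ ∂_λ φ^A ) − δ^μ_0 Σ_σ ∂_σ( Σ_A π_A^σ ∂_λ φ^A ) + δ^μ_0 Σ_A E_A ∂_λ φ^A (the field-theoretical Hamilton generating identity for X = ∂_0, including the boundary term 2∂_σ( X^{[σ} π_A^{μ]} ∂_λ φ^A )). -/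
/-!
Statement 1: For a smooth first-order Lagrangian `L` and a smooth field `φ`,
the divergence of the Noether (canonical energy) current associated with the
translation `X = ∂₀` equals `Σ_A E_A ∂₀φ^A`.
-/

noncomputable section

open scoped BigOperators

/-- A partial derivative of a slice is a directional derivative of the total function. -/
theorem pd_slice {n : ℕ} {g : ℝ × (Fin n → ℝ) → ℝ} {l : ℝ} {x : Fin n → ℝ}
    (hg : DifferentiableAt ℝ g (l, x)) (i : Fin n) :
    pd i (fun y => g (l, y)) x = fderiv ℝ g (l, x) (0, Pi.single i 1) := by
  have h : HasFDerivAt (fun y => g (l, y)) _ x :=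
    hg.hasFDerivAt.comp x (hasFDerivAt_prodMk_right l x)
  simp [pd, h.fderiv]

/-- The parameter derivative of a slice is a directional derivative of the total function. -/
theorem deriv_slice {n : ℕ} {g : ℝ × (Fin n → ℝ) → ℝ} {l : ℝ} {x : Fin n → ℝ}
    (hg : DifferentiableAt ℝ g (l, x)) :
    deriv (fun t => g (t, x)) l = fderiv ℝ g (l, x) (1, 0) := by
  have h : HasFDerivAt (fun t => g (t, x)) _ l :=
    hg.hasFDerivAt.comp l (hasFDerivAt_prodMk_left l x)
  simp [h.hasDerivAt.deriv]

theorem contDiff_fderiv_apply_const {E : Type*} [NormedAddCommGroup E] [NormedSpace ℝ E]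
    {g : E → ℝ} (hg : ContDiff ℝ (⊤ : ℕ∞) g) (v : E) :
    ContDiff ℝ (⊤ : ℕ∞) (fun p => fderiv ℝ g p v) :=
  (hg.fderiv_right (m := (⊤ : ℕ∞)) le_rfl).clm_apply contDiff_const

/-- Partial derivatives commute with the parameter derivative. -/
theorem deriv_pd_comm {n : ℕ} {g : ℝ × (Fin n → ℝ) → ℝ} (hg : ContDiff ℝ (⊤ : ℕ∞) g)
    (l : ℝ) (x : Fin n → ℝ) (i : Fin n) :
    deriv (fun t => pd i (fun y => g (t, y)) x) l
      = pd i (fun y => deriv (fun t => g (t, y)) l) x := by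
  have hd : Differentiable ℝ g := hg.differentiable (by simp)
  have hd' : Differentiable ℝ (fderiv ℝ g) :=
    (hg.fderiv_right (m := (⊤ : ℕ∞)) le_rfl).differentiable (by simp)
  have hv (v : ℝ × (Fin n → ℝ)) : Differentiable ℝ (fun p => fderiv ℝ g p v) :=
    (contDiff_fderiv_apply_const hg v).differentiable (by simp)
  have hsymm : IsSymmSndFDerivAt ℝ g (l, x) :=
    (contDiff_infty.1 hg 2).contDiffAt.isSymmSndFDerivAt (by simp)
  simp only [pd_slice (hd _), deriv_slice (hd _)]
  rw [deriv_slice (hv _ _), pd_slice (hv _ _)]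
  simpa [fderiv_clm_apply (hd' _) (differentiableAt_const _)] using hsymm (1, 0) (0, Pi.single i 1)

/-- Expansion of a linear functional on first jets in the coordinate basis. -/
theorem jet_functional_expand {m n : ℕ}
    (T : (Fin m → ℝ) × (Fin m → Fin n → ℝ) →L[ℝ] ℝ) (u : Fin m → ℝ) (w : Fin m → Fin n → ℝ) :
    T (u, w) = (∑ A, T (Pi.single A 1, 0) * u A)
      + ∑ A, ∑ σ, T (0, Pi.single A (Pi.single σ 1)) * w A σ := by
  have hu : u = ∑ A, u A • Pi.single A (1 : ℝ) := pi_eq_sum_univ' u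
  have hw : w = ∑ A, ∑ σ, w A σ • Pi.single A (Pi.single σ (1 : ℝ)) := by
    ext A σ
    simp [Finset.sum_apply, Pi.single_apply, ite_apply]
  have h₁ : T (u, 0) = ∑ A, T (Pi.single A 1, 0) * u A := by
    change (T.comp (ContinuousLinearMap.inl ℝ _ _)) u = _
    conv_lhs => rw [hu]
    simp [mul_comm]
  have h₂ : T (0, w) = ∑ A, ∑ σ, T (0, Pi.single A (Pi.single σ 1)) * w A σ := by
    change (T.comp (ContinuousLinearMap.inr ℝ _ _)) w = _
    conv_lhs => rw [hw]
    simp [mul_comm]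
  rw [← h₁, ← h₂, ← map_add]
  simp

section Family

variable {m n : ℕ} {L : (Fin m → ℝ) × (Fin m → Fin n → ℝ) → ℝ}
  {Φ : ℝ → (Fin n → ℝ) → (Fin m → ℝ)}

theorem contDiff_component_s3
    (hΦ : ContDiff ℝ (⊤ : ℕ∞) (fun p : ℝ × (Fin n → ℝ) => Φ p.1 p.2)) (A : Fin m) :
    ContDiff ℝ (⊤ : ℕ∞) (fun p : ℝ × (Fin n → ℝ) => Φ p.1 p.2 A) :=
  contDiff_pi.1 hΦ A

theorem contDiff_pd_component
    (hΦ : ContDiff ℝ (⊤ : ℕ∞) (fun p : ℝ × (Fin n → ℝ) => Φ p.1 p.2)) (A : Fin m) (σ : Fin n) :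
    ContDiff ℝ (⊤ : ℕ∞) (fun p : ℝ × (Fin n → ℝ) => pd σ (fun y => Φ p.1 y A) p.2) := by
  have hA := contDiff_component_s3 hΦ A
  convert contDiff_fderiv_apply_const hA (0, Pi.single σ 1) using 2 with p
  exact pd_slice (hA.differentiable (by simp) (p.1, p.2)) σ

theorem contDiff_deriv_component
    (hΦ : ContDiff ℝ (⊤ : ℕ∞) (fun p : ℝ × (Fin n → ℝ) => Φ p.1 p.2)) (A : Fin m) (l : ℝ) :
    ContDiff ℝ (⊤ : ℕ∞) (fun y => deriv (fun t => Φ t y A) l) := by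
  have hA := contDiff_component_s3 hΦ A
  convert (contDiff_fderiv_apply_const hA (1, 0)).comp (contDiff_prodMk_right l) using 2 with y
  exact deriv_slice (hA.differentiable (by simp) (l, y))

theorem contDiff_jet_s3
    (hΦ : ContDiff ℝ (⊤ : ℕ∞) (fun p : ℝ × (Fin n → ℝ) => Φ p.1 p.2)) :
    ContDiff ℝ (⊤ : ℕ∞) (fun p : ℝ × (Fin n → ℝ) => jet (Φ p.1) p.2) :=
  hΦ.prodMk (contDiff_pi.2 fun A => contDiff_pi.2 fun σ => contDiff_pd_component hΦ A σ)

theorem contDiff_mom_s3 (hL : ContDiff ℝ (⊤ : ℕ∞) L)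
    (hΦ : ContDiff ℝ (⊤ : ℕ∞) (fun p : ℝ × (Fin n → ℝ) => Φ p.1 p.2)) (A : Fin m) (σ : Fin n) :
    ContDiff ℝ (⊤ : ℕ∞) (fun p : ℝ × (Fin n → ℝ) => mom L (Φ p.1) A σ p.2) :=
  (contDiff_fderiv_apply_const hL _).comp (contDiff_jet_s3 hΦ)

/-- First variation of the Lagrangian along a one-parameter family of fields. -/
theorem hasDerivAt_lagrangian_jet (hL : ContDiff ℝ (⊤ : ℕ∞) L)
    (hΦ : ContDiff ℝ (⊤ : ℕ∞) (fun p : ℝ × (Fin n → ℝ) => Φ p.1 p.2)) (l : ℝ) (x : Fin n → ℝ) :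
    HasDerivAt (fun t => L (jet (Φ t) x))
      ((∑ A, momF L (Φ l) A x * deriv (fun t => Φ t x A) l)
        + ∑ A, ∑ σ, mom L (Φ l) A σ x * pd σ (fun y => deriv (fun t => Φ t y A) l) x) l := by
  have hslice {g : ℝ × (Fin n → ℝ) → ℝ} (hg : ContDiff ℝ (⊤ : ℕ∞) g) :
      HasDerivAt (fun t => g (t, x)) (deriv (fun t => g (t, x)) l) l :=
    ((hg.comp (contDiff_prodMk_left x)).differentiable (by simp) l).hasDerivAt
  have hjet : HasDerivAt (fun t => jet (Φ t) x) (fun A => deriv (fun t => Φ t x A) l,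
      fun A σ => pd σ (fun y => deriv (fun t => Φ t y A) l) x) l := by
    refine HasDerivAt.prodMk (hasDerivAt_pi.2 fun A => hslice (contDiff_component_s3 hΦ A))
      (hasDerivAt_pi.2 fun A => hasDerivAt_pi.2 fun σ => ?_)
    rw [← deriv_pd_comm (contDiff_component_s3 hΦ A) l x σ]
    exact hslice (contDiff_pd_component hΦ A σ)
  have h := (hL.differentiable (by simp) (jet (Φ l) x)).hasFDerivAt.comp_hasDerivAt l hjet
  rw [jet_functional_expand] at h
  exact h

/-- Leibniz rule for the divergence-type terms `∂_ρ (Σ_A π_A^σ ∂_λ φ^A)`. -/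
theorem pd_sum_mom_mul_deriv (hL : ContDiff ℝ (⊤ : ℕ∞) L)
    (hΦ : ContDiff ℝ (⊤ : ℕ∞) (fun p : ℝ × (Fin n → ℝ) => Φ p.1 p.2)) (l : ℝ) (x : Fin n → ℝ)
    (ρ σ : Fin n) :
    pd ρ (fun y => ∑ A, mom L (Φ l) A σ y * deriv (fun t => Φ t y A) l) x
      = ∑ A, (mom L (Φ l) A σ x * pd ρ (fun y => deriv (fun t => Φ t y A) l) x
        + pd ρ (mom L (Φ l) A σ) x * deriv (fun t => Φ t x A) l) := by
  have hm (A : Fin m) : DifferentiableAt ℝ (mom L (Φ l) A σ) x :=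
    ((contDiff_mom_s3 hL hΦ A σ).comp (contDiff_prodMk_right l)).differentiable (by simp) x
  have hd (A : Fin m) : DifferentiableAt ℝ (fun y => deriv (fun t => Φ t y A) l) x :=
    (contDiff_deriv_component hΦ A l).differentiable (by simp) x
  have h := HasFDerivAt.fun_sum (u := Finset.univ)
    fun A _ => (hm A).hasFDerivAt.mul (hd A).hasFDerivAt
  unfold pd
  refine (congrArg (fun T => T (Pi.single ρ 1)) h.fderiv).trans ?_
  simp [mul_comm]

/-- Variation of the Noether current along a one-parameter family of fields. -/
theorem deriv_noether [NeZero n] (hL : ContDiff ℝ (⊤ : ℕ∞) L)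
    (hΦ : ContDiff ℝ (⊤ : ℕ∞) (fun p : ℝ × (Fin n → ℝ) => Φ p.1 p.2)) (l : ℝ) (μ : Fin n)
    (x : Fin n → ℝ) :
    deriv (fun t => noether L (Φ t) μ x) l
      = (∑ A, (deriv (fun t => mom L (Φ t) A μ x) l * pd 0 (fun y => Φ l y A) x
          + mom L (Φ l) A μ x * pd 0 (fun y => deriv (fun t => Φ t y A) l) x))
        - (if μ = 0 then (∑ A, momF L (Φ l) A x * deriv (fun t => Φ t x A) l)
          + ∑ A, ∑ σ, mom L (Φ l) A σ x * pd σ (fun y => deriv (fun t => Φ t y A) l) x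
          else 0) := by
  have hslice {g : ℝ × (Fin n → ℝ) → ℝ} (hg : ContDiff ℝ (⊤ : ℕ∞) g) :
      HasDerivAt (fun t => g (t, x)) (deriv (fun t => g (t, x)) l) l :=
    ((hg.comp (contDiff_prodMk_left x)).differentiable (by simp) l).hasDerivAt
  have hsum := HasDerivAt.fun_sum (u := Finset.univ) fun A _ =>
    (hslice (contDiff_mom_s3 hL hΦ A μ)).mul (hslice (contDiff_pd_component hΦ A 0))
  have hcomm (A : Fin m) := deriv_pd_comm (contDiff_component_s3 hΦ A) l x 0
  dsimp only at hsum hcomm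
  simp only [hcomm] at hsum
  refine (hsum.sub (g := fun t => if μ = 0 then L (jet (Φ t) x) else 0) ?_).deriv
  split_ifs
  · exact hasDerivAt_lagrangian_jet hL hΦ l x
  · exact hasDerivAt_const l 0

end Family

/-- field-theoretical Hamilton generating identity for `X = ∂₀`.
For a smooth one-parameter family `Φ` of fields, the parameter derivative of the
Noether current decomposes as
`∂_λ H^μ = Σ_A (∂₀Φ^A ∂_λπ_A^μ − ∂₀π_A^μ ∂_λΦ^A) + ∂₀(Σ_A π_A^μ ∂_λΦ^A)
  − δ^μ₀ Σ_σ ∂_σ(Σ_A π_A^σ ∂_λΦ^A) + δ^μ₀ Σ_A E_A ∂_λΦ^A`. -/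
theorem hamilton_generating_identity {m n : ℕ} [NeZero n]
    (L : (Fin m → ℝ) × (Fin m → Fin n → ℝ) → ℝ) (hL : ContDiff ℝ (⊤ : ℕ∞) L)
    (Φ : ℝ → (Fin n → ℝ) → (Fin m → ℝ))
    (hΦ : ContDiff ℝ (⊤ : ℕ∞) (fun p : ℝ × (Fin n → ℝ) => Φ p.1 p.2))
    (lam : ℝ) (μ : Fin n) (x : Fin n → ℝ) :
    deriv (fun l => noether L (Φ l) μ x) lam
      = (∑ A, (pd 0 (fun y => Φ lam y A) x * deriv (fun l => mom L (Φ l) A μ x) lam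
            - pd 0 (mom L (Φ lam) A μ) x * deriv (fun l => Φ l x A) lam))
        + pd 0 (fun y => ∑ A, mom L (Φ lam) A μ y * deriv (fun l => Φ l y A) lam) x
        - (if μ = 0 then
            ∑ σ, pd σ (fun y => ∑ A, mom L (Φ lam) A σ y * deriv (fun l => Φ l y A) lam) x
          else 0)
        + (if μ = 0 then ∑ A, EL L (Φ lam) A x * deriv (fun l => Φ l x A) lam else 0) := by
  rw [deriv_noether hL hΦ]
  simp only [pd_sum_mom_mul_deriv hL hΦ]
  split_ifs
  · rw [Finset.sum_comm (s := (Finset.univ : Finset (Fin n)))]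
    simp only [EL, sub_mul, Finset.sum_mul, Finset.sum_add_distrib, Finset.sum_sub_distrib,
      mul_comm (pd 0 (fun y => Φ lam y _) x)]
    ring
  · simp only [Finset.sum_add_distrib, Finset.sum_sub_distrib,
      mul_comm (pd 0 (fun y => Φ lam y _) x)]
    ring
end
end
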